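/- arXiv:2405.00756 — 2 statements merged into one kernel-verified Lean document; each statement's English description precedes it below -/
import Mathlib

section
/- Let λ be a partition of n and T ∈ RSSYT(λ). Then in the field ℚ(q,t): 1/K_T(q,t) = Σ_{τ ∈ PSYT(λ;T)} t^{inv(τ)} · Π_{(□_1,□_2) ∈ Inv(τ)} (1 − q^{T(□_2)−T(□_1)} t^{c(□_2)−c(□_1)−1})/(1 − q^{T(□_2)−T(□_1)} t^{c(□_2)−c(□_1)+1}). -/
open scoped Classical

/-- The content of a box `(i, j)` (row `i`, column `j`, both 0-indexed): `c(□) = j - i`. -/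
def content (c : ℕ × ℕ) : ℤ := (c.2 : ℤ) - (c.1 : ℤ)

/-- The order on the formal labels `j·q^b` (encoded as pairs `(j, b)`):
`j·q^m < k·q^ℓ` iff `m > ℓ`, or `m = ℓ` and `j < k`. -/
def labelLT (x y : ℕ × ℕ) : Prop := y.2 < x.2 ∨ (x.2 = y.2 ∧ x.1 < y.1)

/-- `τ` is a (non-negative) periodic standard Young tableau on the finite cell set `s`
(a labelling of the boxes by symbols `j·q^b`, encoded as pairs `(j, b)`): each number
`1 ≤ j ≤ s.card` occurs in exactly one box, the labels strictly increase along rows and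
columns, and `τ` is normalized to `(0, 0)` off `s`. -/
def IsPSYT (s : Finset (ℕ × ℕ)) (τ : ℕ × ℕ → ℕ × ℕ) : Prop :=
  (∀ j, 1 ≤ j → j ≤ s.card → ∃! c, c ∈ s ∧ (τ c).1 = j) ∧
  (∀ c ∈ s, ∀ c' ∈ s, c.1 = c'.1 → c.2 + 1 = c'.2 → labelLT (τ c) (τ c')) ∧
  (∀ c ∈ s, ∀ c' ∈ s, c.1 + 1 = c'.1 → c.2 = c'.2 → labelLT (τ c) (τ c')) ∧
  (∀ c, c ∉ s → τ c = (0, 0))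

/-- `T` is a non-negative reverse Young tableau on `s`: entries weakly decrease along rows
and down columns (normalized to `0` off `s`). -/
def IsRYT (s : Finset (ℕ × ℕ)) (T : ℕ × ℕ → ℕ) : Prop :=
  (∀ c ∈ s, ∀ c' ∈ s, c.1 = c'.1 → c.2 + 1 = c'.2 → T c' ≤ T c) ∧
  (∀ c ∈ s, ∀ c' ∈ s, c.1 + 1 = c'.1 → c.2 = c'.2 → T c' ≤ T c) ∧
  (∀ c, c ∉ s → T c = 0)

/-- `T` is a non-negative reverse semi-standard Young tableau on `s`: entries weakly
decrease along rows and strictly decrease down columns (normalized to `0` off `s`). -/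
def IsRSSYT (s : Finset (ℕ × ℕ)) (T : ℕ × ℕ → ℕ) : Prop :=
  (∀ c ∈ s, ∀ c' ∈ s, c.1 = c'.1 → c.2 + 1 = c'.2 → T c' ≤ T c) ∧
  (∀ c ∈ s, ∀ c' ∈ s, c.1 + 1 = c'.1 → c.2 = c'.2 → T c' < T c) ∧
  (∀ c, c ∉ s → T c = 0)

/-- `τ ∈ PSYT(λ; T)`: a periodic standard Young tableau whose `q`-exponents are given
by `T`. -/
def InFiber (s : Finset (ℕ × ℕ)) (T : ℕ × ℕ → ℕ) (τ : ℕ × ℕ → ℕ × ℕ) : Prop :=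
  IsPSYT s τ ∧ ∀ c ∈ s, (τ c).2 = T c

/-- Column-standard reading order on boxes: columns left to right, each column top to
bottom. -/
def colReadLT (c c' : ℕ × ℕ) : Prop := c.2 < c'.2 ∨ (c.2 = c'.2 ∧ c.1 < c'.1)

/-- Row-standard reading order on boxes: rows top to bottom, left to right in each row. -/
def rowReadLT (c c' : ℕ × ℕ) : Prop := c.1 < c'.1 ∨ (c.1 = c'.1 ∧ c.2 < c'.2)

/-- The box order `□ <_T □'`: `T □ > T □'`, or `T □ = T □'` and `□` precedes `□'` in the
column-standard reading order. -/
def boxLT (T : ℕ × ℕ → ℕ) (c c' : ℕ × ℕ) : Prop :=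
  T c' < T c ∨ (T c = T c' ∧ colReadLT c c')

/-- The set `Inv(τ)` of inversion pairs of `τ` (with `q`-exponents `T`): ordered pairs of
boxes `(□₁, □₂)` with `□₁ <_T □₂` whose number labels are in decreasing order. -/
noncomputable def invSet (s : Finset (ℕ × ℕ)) (T : ℕ × ℕ → ℕ) (τ : ℕ × ℕ → ℕ × ℕ) :
    Finset ((ℕ × ℕ) × (ℕ × ℕ)) :=
  (s ×ˢ s).filter fun p => boxLT T p.1 p.2 ∧ (τ p.2).1 < (τ p.1).1

/-- `inv(τ) = |Inv(τ)|`. -/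
noncomputable def invNum (s : Finset (ℕ × ℕ)) (T : ℕ × ℕ → ℕ) (τ : ℕ × ℕ → ℕ × ℕ) : ℕ :=
  (invSet s T τ).card

/-- The auxiliary reading order used to define `Min(T)`: boxes with smaller `T`-value come
first, boxes of equal `T`-value in row-standard reading order. -/
def minOrd (T : ℕ × ℕ → ℕ) (c c' : ℕ × ℕ) : Prop :=
  T c < T c' ∨ (T c = T c' ∧ rowReadLT c c')

/-- The tableau `Min(T) ∈ PSYT(λ;T)`: `q`-exponents given by `T`, numbers `1, …, n`
assigned so that boxes with larger `T`-value receive larger numbers, boxes of equal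
`T`-value being numbered consecutively in row-standard reading order. -/
noncomputable def minTab (s : Finset (ℕ × ℕ)) (T : ℕ × ℕ → ℕ) : ℕ × ℕ → ℕ × ℕ :=
  fun c => if c ∈ s then ((s.filter fun c' => minOrd T c' c).card + 1, T c) else (0, 0)

/-- The `t`-factorial `[m]_t! = Π_{i=1}^m (1 − t^i)/(1 − t)`. -/
noncomputable def tFact {F : Type*} [Field F] (t : F) (m : ℕ) : F :=
  ∏ i ∈ Finset.Icc 1 m, (1 - t ^ i) / (1 - t)

/-- The position of the box `c` within its maximal run of contiguous boxes in its row
sharing a common `T`-value. -/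
noncomputable def runPos (s : Finset (ℕ × ℕ)) (T : ℕ × ℕ → ℕ) (c : ℕ × ℕ) : ℕ :=
  ((Finset.range (c.2 + 1)).filter fun l =>
    ∀ m, l ≤ m → m ≤ c.2 → ((c.1, m) ∈ s ∧ T (c.1, m) = T c)).card

/-- `[μ(T)]_t!`, where the parts of the composition `μ(T)` are the sizes of the maximal
sets of contiguous boxes within a single row of `λ` sharing a common `T`-value. -/
noncomputable def muFact {F : Type*} [Field F] (t : F) (s : Finset (ℕ × ℕ))
    (T : ℕ × ℕ → ℕ) : F :=
  ∏ c ∈ s, (1 - t ^ runPos s T c) / (1 - t)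

/-- The coefficient `K_T(q,t) = ([μ(T)]_t!/[n]_t!) ·
Π_{(□₁,□₂) ∈ I(T)} (q^{T□₁}t^{c□₁} − q^{T□₂}t^{c□₂+1})/(q^{T□₁}t^{c□₁} − q^{T□₂}t^{c□₂})`,
where `I(T) = Inv(Min(T))`. -/
noncomputable def Kcoef {F : Type*} [Field F] (q t : F) (s : Finset (ℕ × ℕ))
    (T : ℕ × ℕ → ℕ) : F :=
  (muFact t s T / tFact t s.card) *
    ∏ p ∈ invSet s T (minTab s T),
      (q ^ T p.1 * t ^ content p.1 - q ^ T p.2 * t ^ (content p.2 + 1)) /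
        (q ^ T p.1 * t ^ content p.1 - q ^ T p.2 * t ^ content p.2)

/-- The field `ℚ(q,t)` of rational functions in two variables over `ℚ`. -/
abbrev QQt : Type := FractionRing (MvPolynomial (Fin 2) ℚ)

/-- The element `q` of `ℚ(q,t)`. -/
noncomputable def qParam : QQt := algebraMap (MvPolynomial (Fin 2) ℚ) QQt (MvPolynomial.X 0)

/-- The element `t` of `ℚ(q,t)`. -/
noncomputable def tParam : QQt := algebraMap (MvPolynomial (Fin 2) ℚ) QQt (MvPolynomial.X 1)

open Polynomial in
theorem sum_prod_sub_mul_div_sub {F ι : Type*} [Field F] [Fintype ι] [DecidableEq ι] {t : F} (ht : t ≠ 1)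
    {z : ι → F} (hz : Function.Injective z) (h0 : ∀ i, z i ≠ 0) :
    ∑ a, ∏ b ∈ Finset.univ.erase a, (z a - t * z b) / (z a - z b) =
      (1 - t ^ Fintype.card ι) / (1 - t) := by
  have ht' : 1 - t ≠ 0 := sub_ne_zero.2 ht.symm
  set P : F[X] := ∏ b, (X - C (t * z b)) with hP
  set Q : F[X] := ∏ b, (X - C (z b)) with hQ
  have hPm : P.Monic := monic_prod_of_monic _ _ fun b _ => monic_X_sub_C _
  have hQm : Q.Monic := monic_prod_of_monic _ _ fun b _ => monic_X_sub_C _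
  have hPd : P.degree = (Finset.univ : Finset ι).card := by simp only [hP, degree_prod, degree_X_sub_C]; simp
  have hQd : Q.degree = (Finset.univ : Finset ι).card := by simp only [hQ, degree_prod, degree_X_sub_C]; simp
  have hdeg : (P - Q).degree < (Finset.univ : Finset ι).card := by
    rw [← hPd]
    exact degree_sub_lt_left (hPd.trans hQd.symm) hPm.ne_zero
      (hPm.leadingCoeff.trans hQm.leadingCoeff.symm)
  have hint := congrArg (eval 0)
    (Lagrange.eq_interpolate (s := Finset.univ) (v := z) hz.injOn hdeg)
  have hprod : ∏ b, z b ≠ 0 := Finset.prod_ne_zero_iff.2 fun b _ => h0 b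
  have hterm : ∀ a, eval 0 (C (eval (z a) (P - Q)) * Lagrange.basis Finset.univ z a) =
      -(1 - t) * (∏ b, -z b) *
        ∏ b ∈ Finset.univ.erase a, (z a - t * z b) / (z a - z b) := by
    intro a
    have hQa : eval (z a) Q = 0 := by
      rw [hQ, eval_prod]
      exact Finset.prod_eq_zero (Finset.mem_univ a) (by simp)
    rw [eval_mul, eval_C, eval_sub, hQa, sub_zero, hP, eval_prod, Lagrange.basis, eval_prod,
      ← Finset.mul_prod_erase Finset.univ _ (Finset.mem_univ a),
      ← Finset.mul_prod_erase Finset.univ (fun b => -z b) (Finset.mem_univ a), mul_assoc,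
      ← Finset.prod_mul_distrib, mul_assoc, mul_assoc, ← Finset.prod_mul_distrib, ← mul_assoc]
    congr 1
    · simp; ring
    · refine Finset.prod_congr rfl fun b _ => ?_
      simp [Lagrange.basisDivisor]; ring
  rw [Lagrange.interpolate_apply, eval_finsetSum, Finset.sum_congr rfl fun a _ => hterm a,
    ← Finset.mul_sum, eval_sub, hP, hQ, eval_prod, eval_prod] at hint
  have hneg : ∏ b, -z b ≠ 0 := Finset.prod_ne_zero_iff.2 fun b _ => neg_ne_zero.2 (h0 b)
  have hl : ∏ b, eval 0 (X - C (t * z b)) = t ^ Fintype.card ι * ∏ b, -z b := by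
    rw [← Finset.card_univ, ← Finset.prod_const, ← Finset.prod_mul_distrib]
    exact Finset.prod_congr rfl fun b _ => by simp
  have hr : ∏ b, eval 0 (X - C (z b)) = ∏ b, -z b :=
    Finset.prod_congr rfl fun b _ => by simp
  rw [hl, hr] at hint
  rw [eq_div_iff ht']
  refine mul_left_cancel₀ hneg ?_
  linear_combination hint

theorem tFact_succ {F : Type*} [Field F] (t : F) (n : ℕ) :
    tFact t (n + 1) = (1 - t ^ (n + 1)) / (1 - t) * tFact t n := by
  rw [tFact, Finset.prod_Icc_succ_top (by omega), mul_comm, tFact]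

theorem sum_perm_prod_sub_mul_div_sub {F : Type*} [Field F] {t : F} (ht : t ≠ 1) (n : ℕ)
    {z : Fin n → F} (hz : Function.Injective z) (h0 : ∀ i, z i ≠ 0) :
    ∑ σ : Equiv.Perm (Fin n), ∏ i, ∏ j ∈ Finset.Ioi i,
      (z (σ i) - t * z (σ j)) / (z (σ i) - z (σ j)) = tFact t n := by
  induction n with
  | zero => simp [tFact]
  | succ n ih =>
    rw [tFact_succ, ← Equiv.sum_comp Equiv.Perm.decomposeFin.symm, Fintype.sum_prod_type]
    have key : ∀ p : Fin (n + 1), ∑ e : Equiv.Perm (Fin n), ∏ i, ∏ j ∈ Finset.Ioi i,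
        (z (Equiv.Perm.decomposeFin.symm (p, e) i) -
          t * z (Equiv.Perm.decomposeFin.symm (p, e) j)) /
        (z (Equiv.Perm.decomposeFin.symm (p, e) i) - z (Equiv.Perm.decomposeFin.symm (p, e) j)) =
        (∏ b ∈ Finset.univ.erase p, (z p - t * z b) / (z p - z b)) * tFact t n := by
      intro p
      rw [← ih (z := fun i => z (Equiv.swap 0 p i.succ))
        (fun i j h => Fin.succ_injective _ ((Equiv.swap 0 p).injective (hz h)))
        (fun i => h0 _), Finset.mul_sum]
      refine Finset.sum_congr rfl fun e _ => ?_
      have hfirst : ∏ b ∈ Finset.univ.erase p, (z p - t * z b) / (z p - z b) =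
          ∏ i : Fin n, (z p - t * z (Equiv.swap 0 p (e i).succ)) /
            (z p - z (Equiv.swap 0 p (e i).succ)) := by
        rw [Equiv.prod_comp e fun i => (z p - t * z (Equiv.swap 0 p i.succ)) /
            (z p - z (Equiv.swap 0 p i.succ))]
        symm
        refine Finset.prod_bij (fun i _ => Equiv.swap 0 p i.succ) ?_ ?_ ?_ ?_
        · intro i _
          simp only [Finset.mem_erase, Finset.mem_univ, and_true]
          intro h
          have := (Equiv.swap 0 p).injective (h.trans (Equiv.swap_apply_left 0 p).symm)
          exact Fin.succ_ne_zero _ this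
        · intro i _ j _ h
          exact Fin.succ_injective _ ((Equiv.swap 0 p).injective h)
        · intro b hb
          have hb' : Equiv.swap 0 p b ≠ 0 := fun h => by
            have := (Equiv.swap 0 p).injective (h.trans (Equiv.swap_apply_right 0 p).symm)
            simp [this] at hb
          obtain ⟨i, hi⟩ := Fin.exists_succ_eq.2 hb'
          exact ⟨i, Finset.mem_univ _, by rw [hi, Equiv.swap_apply_self]⟩
        · intro i _; rfl
      rw [Fin.prod_univ_succ, hfirst]
      simp [Fin.Ioi_zero_eq_map, ← Fin.map_succEmb_Ioi]
    rw [Finset.sum_congr rfl fun p _ => key p, ← Finset.sum_mul,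
      sum_prod_sub_mul_div_sub ht hz h0, Fintype.card_fin]

theorem prod_Ico_one_sub_pow_div {F : Type*} [Field F] {t : F} (ht : ∀ k : ℕ, 0 < k → t ^ k ≠ 1)
    (a d : ℕ) :
    ∏ j ∈ Finset.Ico a (a + d), (1 - t ^ (a + d - j + 1)) / (1 - t ^ (a + d - j)) =
      (1 - t ^ (d + 1)) / (1 - t) := by
  have h1 : ∀ k : ℕ, 0 < k → 1 - t ^ k ≠ 0 := fun k hk => sub_ne_zero.2 (ht k hk).symm
  have h2 : 1 - t ≠ 0 := by simpa using h1 1 one_pos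
  induction d generalizing a with
  | zero => simp [h2]
  | succ d ih =>
    have h3 := h1 (d + 1) (by omega)
    rw [Finset.prod_eq_prod_Ico_succ_bot (by omega), show a + (d + 1) = a + 1 + d by omega, ih,
      show a + 1 + d - a = d + 1 by omega]
    field_simp

/-- The weight `q^{T(□)} t^{c(□)}` of a box. -/
noncomputable def boxWeight {F : Type*} [Field F] (q t : F) (T : ℕ × ℕ → ℕ) (c : ℕ × ℕ) : F :=
  q ^ T c * t ^ content c

theorem boxLT_irrefl (T : ℕ × ℕ → ℕ) (c : ℕ × ℕ) : ¬ boxLT T c c := by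
  simp [boxLT, colReadLT]

theorem boxLT_asymm {T : ℕ × ℕ → ℕ} {c c' : ℕ × ℕ} (h : boxLT T c c') : ¬ boxLT T c' c := by
  simp only [boxLT, colReadLT] at *
  omega

theorem boxLT_total (T : ℕ × ℕ → ℕ) {c c' : ℕ × ℕ} (h : c ≠ c') :
    boxLT T c c' ∨ boxLT T c' c := by
  simp only [boxLT, colReadLT, ne_eq, Prod.ext_iff] at *
  omega

theorem minOrd_irrefl (T : ℕ × ℕ → ℕ) (c : ℕ × ℕ) : ¬ minOrd T c c := by
  simp [minOrd, rowReadLT]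

theorem minOrd_trans {T : ℕ × ℕ → ℕ} {c c' c'' : ℕ × ℕ} (h : minOrd T c c')
    (h' : minOrd T c' c'') : minOrd T c c'' := by
  simp only [minOrd, rowReadLT] at *
  omega

theorem minOrd_total (T : ℕ × ℕ → ℕ) {c c' : ℕ × ℕ} (h : c ≠ c') :
    minOrd T c c' ∨ minOrd T c' c := by
  simp only [minOrd, rowReadLT, ne_eq, Prod.ext_iff] at *
  omega

theorem minTab_lt_of_minOrd {s : Finset (ℕ × ℕ)} {T : ℕ × ℕ → ℕ} {c c' : ℕ × ℕ} (hc : c ∈ s)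
    (hc' : c' ∈ s) (h : minOrd T c c') : (minTab s T c).1 < (minTab s T c').1 := by
  simp only [minTab, hc, hc', if_true, add_lt_add_iff_right]
  refine Finset.card_lt_card (Finset.ssubset_iff_of_subset ?_ |>.2 ⟨c, ?_, ?_⟩)
  · intro d hd
    simp only [Finset.mem_filter] at *
    exact ⟨hd.1, minOrd_trans hd.2 h⟩
  · simp [hc, h]
  · simp [minOrd_irrefl]

theorem minTab_lt_iff {s : Finset (ℕ × ℕ)} {T : ℕ × ℕ → ℕ} {c c' : ℕ × ℕ} (hc : c ∈ s)
    (hc' : c' ∈ s) : (minTab s T c).1 < (minTab s T c').1 ↔ minOrd T c c' := by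
  refine ⟨fun h => ?_, minTab_lt_of_minOrd hc hc'⟩
  have hne : c ≠ c' := by rintro rfl; exact lt_irrefl _ h
  exact (minOrd_total T hne).resolve_right fun h' =>
    lt_asymm h (minTab_lt_of_minOrd hc' hc h')

section RSSYT

variable {μ : YoungDiagram} {T : ℕ × ℕ → ℕ}

theorem IsRSSYT.row_le (hT : IsRSSYT μ.cells T) {i j j' : ℕ} (hj : j' ≤ j) (h : (i, j) ∈ μ.cells) :
    T (i, j) ≤ T (i, j') := by
  induction j, hj using Nat.le_induction with
  | base => exact le_rfl
  | succ j _ ih =>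
    have h' : (i, j) ∈ μ.cells := μ.isLowerSet (by simp) h
    exact (hT.1 _ h' _ h rfl rfl).trans (ih h')

theorem IsRSSYT.col_lt (hT : IsRSSYT μ.cells T) {i i' j : ℕ} (hi : i' < i)
    (h : (i, j) ∈ μ.cells) : T (i, j) < T (i', j) := by
  induction i, hi using Nat.le_induction with
  | base => exact hT.2.1 _ (μ.isLowerSet (by simp) h) _ h rfl rfl
  | succ i _ ih =>
    have h' : (i, j) ∈ μ.cells := μ.isLowerSet (by simp) h
    exact (hT.2.1 _ h' _ h rfl rfl).trans (ih h')

theorem IsRSSYT.lt_of_lt_of_le (hT : IsRSSYT μ.cells T) {c c' : ℕ × ℕ} (hi : c'.1 < c.1)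
    (hj : c'.2 ≤ c.2) (h : c ∈ μ.cells) : T c < T c' :=
  (hT.col_lt hi (j := c.2) h).trans_le
    (hT.row_le hj (i := c'.1) (μ.isLowerSet (Prod.mk_le_mk.2 ⟨hi.le, le_rfl⟩) h))

theorem IsRSSYT.boxLT_and_not_minOrd_iff (hT : IsRSSYT μ.cells T) {c c' : ℕ × ℕ}
    (hc' : c' ∈ μ.cells) :
    boxLT T c c' ∧ ¬ minOrd T c' c ↔ c.1 = c'.1 ∧ c.2 < c'.2 ∧ T c = T c' := by
  have h := fun hi hj => hT.lt_of_lt_of_le (c := c') (c' := c) hi hj hc'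
  simp only [boxLT, colReadLT, minOrd, rowReadLT]
  omega

variable {F : Type*} [Field F] {q t : F}

theorem boxWeight_ne_zero (hq : q ≠ 0) (ht : t ≠ 0) (c : ℕ × ℕ) : boxWeight q t T c ≠ 0 :=
  mul_ne_zero (pow_ne_zero _ hq) (zpow_ne_zero _ ht)

theorem eq_of_boxWeight_eq (hq : q ≠ 0) (ht : t ≠ 0)
    (hqt : ∀ a b : ℤ, q ^ a * t ^ b = 1 → a = 0 ∧ b = 0) {c c' : ℕ × ℕ} {k : ℤ}
    (h : boxWeight q t T c = t ^ k * boxWeight q t T c') :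
    T c = T c' ∧ content c = content c' + k := by
  have h1 := hqt (T c - T c') (content c - content c' - k) ?_
  · omega
  · have hx : q ^ T c' ≠ 0 := pow_ne_zero _ hq
    have hy : t ^ content c' ≠ 0 := zpow_ne_zero _ ht
    have hk : t ^ k ≠ 0 := zpow_ne_zero _ ht
    simp only [boxWeight] at h
    rw [zpow_sub₀ hq, zpow_sub₀ ht, zpow_sub₀ ht, zpow_natCast, zpow_natCast]
    field_simp
    linear_combination h

theorem IsRSSYT.boxWeight_injOn (hT : IsRSSYT μ.cells T) (hq : q ≠ 0) (ht : t ≠ 0)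
    (hqt : ∀ a b : ℤ, q ^ a * t ^ b = 1 → a = 0 ∧ b = 0) :
    Set.InjOn (boxWeight q t T) μ.cells := by
  intro c hc c' hc' h
  obtain ⟨h1, h2⟩ := eq_of_boxWeight_eq (k := 0) hq ht hqt (by simpa using h)
  have h3 := fun hi hj => hT.lt_of_lt_of_le (c := c') (c' := c) hi hj hc'
  have h4 := fun hi hj => hT.lt_of_lt_of_le (c := c) (c' := c') hi hj hc
  simp only [content, Prod.ext_iff] at *
  omega

theorem IsRSSYT.boxWeight_sub_ne_zero (hT : IsRSSYT μ.cells T) (hq : q ≠ 0) (ht : t ≠ 0)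
    (hqt : ∀ a b : ℤ, q ^ a * t ^ b = 1 → a = 0 ∧ b = 0) {c c' : ℕ × ℕ}
    (hc' : c' ∈ μ.cells) (hlt : boxLT T c c') :
    boxWeight q t T c - t * boxWeight q t T c' ≠ 0 := by
  intro h
  obtain ⟨h1, h2⟩ := eq_of_boxWeight_eq (k := 1) hq ht hqt (by simpa using sub_eq_zero.1 h)
  have h3 := fun hi hj => hT.lt_of_lt_of_le (c := c') (c' := c) hi hj hc'
  simp only [content, boxLT, colReadLT] at *
  omega

theorem IsRSSYT.exists_run_start (hT : IsRSSYT μ.cells T) {c : ℕ × ℕ} (hc : c ∈ μ.cells) :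
    ∃ a ≤ c.2, ∀ l ≤ c.2, T (c.1, l) = T c ↔ a ≤ l := by
  have hex : ∃ l, T (c.1, l) = T c := ⟨c.2, rfl⟩
  have ha : Nat.find hex ≤ c.2 := Nat.find_min' hex rfl
  refine ⟨Nat.find hex, ha, fun l hl => ⟨fun h => Nat.find_min' hex h, fun h => ?_⟩⟩
  have h1 := hT.row_le (i := c.1) h (μ.isLowerSet (Prod.mk_le_mk.2 ⟨le_rfl, hl⟩) hc)
  have h2 := hT.row_le (i := c.1) hl hc
  rw [Nat.find_spec hex] at h1
  exact le_antisymm h1 h2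

theorem IsRSSYT.prod_run (hT : IsRSSYT μ.cells T) (hq : q ≠ 0) (ht : t ≠ 0)
    (hqt : ∀ a b : ℤ, q ^ a * t ^ b = 1 → a = 0 ∧ b = 0) {c : ℕ × ℕ} (hc : c ∈ μ.cells) :
    ∏ d ∈ μ.cells with d.1 = c.1 ∧ d.2 < c.2 ∧ T d = T c,
      (boxWeight q t T d - t * boxWeight q t T c) / (boxWeight q t T d - boxWeight q t T c) =
      (1 - t ^ runPos μ.cells T c) / (1 - t) := by
  obtain ⟨a, ha, hrun⟩ := hT.exists_run_start hc
  have hmem : ∀ l ≤ c.2, (c.1, l) ∈ μ.cells := fun l hl =>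
    μ.isLowerSet (Prod.mk_le_mk.2 ⟨le_rfl, hl⟩) hc
  have hpos : runPos μ.cells T c = c.2 - a + 1 := by
    have : ((Finset.range (c.2 + 1)).filter fun l =>
        ∀ m, l ≤ m → m ≤ c.2 → ((c.1, m) ∈ μ.cells ∧ T (c.1, m) = T c)) =
        Finset.Ico a (c.2 + 1) := by
      ext l
      simp only [Finset.mem_filter, Finset.mem_range, Finset.mem_Ico]
      constructor
      · rintro ⟨h1, h2⟩
        exact ⟨(hrun l (by omega)).1 (h2 l le_rfl (by omega)).2, h1⟩
      · rintro ⟨h1, h2⟩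
        exact ⟨h2, fun m h3 h4 => ⟨hmem m h4, (hrun m h4).2 (h1.trans h3)⟩⟩
    rw [runPos, this, Nat.card_Ico]
    omega
  have ht1 : ∀ k : ℕ, 0 < k → t ^ k ≠ 1 := fun k hk h => by
    have := (hqt 0 k (by simpa using h)).2
    omega
  have htel := prod_Ico_one_sub_pow_div ht1 a (c.2 - a)
  rw [show a + (c.2 - a) = c.2 by omega] at htel
  rw [hpos, ← htel]
  symm
  refine Finset.prod_bij (fun l _ => (c.1, l)) ?_ ?_ ?_ ?_
  · intro l hl
    rw [Finset.mem_Ico] at hl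
    simp only [Finset.mem_filter]
    exact ⟨hmem l hl.2.le, trivial, hl.2, (hrun l hl.2.le).2 hl.1⟩
  · intro l _ l' _ h
    exact (Prod.ext_iff.1 h).2
  · rintro ⟨i, l⟩ hl
    simp only [Finset.mem_filter] at hl
    obtain ⟨_, rfl, h2, h3⟩ := hl
    exact ⟨l, Finset.mem_Ico.2 ⟨(hrun l h2.le).1 h3, h2⟩, rfl⟩
  · intro l hl
    rw [Finset.mem_Ico] at hl
    have hz : boxWeight q t T c = t ^ (c.2 - l) * boxWeight q t T (c.1, l) := by
      simp only [boxWeight, (hrun l hl.2.le).2 hl.1]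
      rw [← zpow_natCast t, mul_left_comm, ← zpow_add₀ ht]
      congr 2
      simp only [content]
      omega
    have h0 : boxWeight q t T (c.1, l) ≠ 0 := boxWeight_ne_zero hq ht _
    rw [hz, ← mul_div_mul_right _ _ h0]
    congr 1 <;> ring

theorem IsRSSYT.prod_filter_not_minTab_lt (hT : IsRSSYT μ.cells T) (hq : q ≠ 0) (ht : t ≠ 0)
    (hqt : ∀ a b : ℤ, q ^ a * t ^ b = 1 → a = 0 ∧ b = 0) :
    ∏ p ∈ (μ.cells ×ˢ μ.cells).filter fun p =>
        boxLT T p.1 p.2 ∧ ¬ (minTab μ.cells T p.2).1 < (minTab μ.cells T p.1).1,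
      (boxWeight q t T p.1 - t * boxWeight q t T p.2) /
        (boxWeight q t T p.1 - boxWeight q t T p.2) = muFact t μ.cells T := by
  rw [muFact, Finset.prod_filter, Finset.prod_product_right]
  refine Finset.prod_congr rfl fun c hc => ?_
  rw [← hT.prod_run hq ht hqt hc, Finset.prod_filter]
  refine Finset.prod_congr rfl fun d hd => ?_
  simp only [minTab_lt_iff hc hd, hT.boxLT_and_not_minOrd_iff hc]

theorem IsRSSYT.Kcoef_mul_tFact (hT : IsRSSYT μ.cells T) (hq : q ≠ 0) (ht : t ≠ 0)
    (hqt : ∀ a b : ℤ, q ^ a * t ^ b = 1 → a = 0 ∧ b = 0) (hfact : tFact t μ.cells.card ≠ 0) :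
    Kcoef q t μ.cells T * tFact t μ.cells.card =
      ∏ p ∈ (μ.cells ×ˢ μ.cells).filter fun p => boxLT T p.1 p.2,
        (boxWeight q t T p.1 - t * boxWeight q t T p.2) /
          (boxWeight q t T p.1 - boxWeight q t T p.2) := by
  rw [← Finset.prod_filter_mul_prod_filter_not _
      fun p => (minTab μ.cells T p.2).1 < (minTab μ.cells T p.1).1, Finset.filter_filter,
    Finset.filter_filter, hT.prod_filter_not_minTab_lt hq ht hqt, Kcoef, mul_right_comm,
    div_mul_cancel₀ _ hfact, mul_comm]
  congr 1
  refine Finset.prod_congr rfl fun p _ => ?_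
  simp only [boxWeight, zpow_add_one₀ ht]
  ring

end RSSYT

theorem prod_invSet_mul_prod_boxLT {F : Type*} [Field F] {t : F} {z : ℕ × ℕ → F}
    {s : Finset (ℕ × ℕ)} {T : ℕ × ℕ → ℕ} {τ : ℕ × ℕ → ℕ × ℕ}
    (hτ : Set.InjOn (fun c => (τ c).1) s)
    (hz : ∀ c ∈ s, ∀ c' ∈ s, boxLT T c c' → z c - t * z c' ≠ 0) :
    (∏ p ∈ invSet s T τ, (t * z p.1 - z p.2) / (z p.1 - t * z p.2)) *
        ∏ p ∈ (s ×ˢ s).filter fun p => boxLT T p.1 p.2, (z p.1 - t * z p.2) / (z p.1 - z p.2) =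
      ∏ p ∈ (s ×ˢ s).filter fun p => (τ p.1).1 < (τ p.2).1,
        (z p.1 - t * z p.2) / (z p.1 - z p.2) := by
  rw [← Finset.prod_filter_mul_prod_filter_not ((s ×ˢ s).filter fun p => boxLT T p.1 p.2)
      fun p => (τ p.2).1 < (τ p.1).1,
    ← Finset.prod_filter_mul_prod_filter_not ((s ×ˢ s).filter fun p => (τ p.1).1 < (τ p.2).1)
      fun p => boxLT T p.2 p.1, ← mul_assoc]
  simp only [Finset.filter_filter]
  rw [← invSet, ← Finset.prod_mul_distrib]
  congr 1
  · refine Finset.prod_bij (fun p _ => p.swap) ?_ ?_ ?_ ?_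
    · rintro ⟨c, c'⟩ h
      simp only [invSet, Finset.mem_filter, Finset.mem_product, Prod.swap] at *
      tauto
    · intro p _ p' _ h
      exact Prod.swap_injective h
    · rintro ⟨c, c'⟩ h
      refine ⟨(c', c), ?_, rfl⟩
      simp only [invSet, Finset.mem_filter, Finset.mem_product] at *
      tauto
    · rintro ⟨c, c'⟩ h
      simp only [invSet, Finset.mem_filter, Finset.mem_product, Prod.swap] at *
      rw [div_mul_div_cancel₀ (hz c h.1.1 c' h.1.2 h.2.1), ← neg_div_neg_eq]
      congr 1 <;> ring
  · refine Finset.prod_congr (Finset.filter_congr ?_) fun _ _ => rfl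
    rintro ⟨c, c'⟩ h
    rw [Finset.mem_product] at h
    constructor
    · rintro ⟨h1, h2⟩
      have hne : (τ c).1 ≠ (τ c').1 := fun h3 => by
        have h4 : c = c' := hτ h.1 h.2 h3
        exact boxLT_irrefl T c (by simpa [← h4] using h1)
      exact ⟨by simp only at *; omega, boxLT_asymm h1⟩
    · rintro ⟨h1, h2⟩
      have hne : c ≠ c' := by rintro rfl; exact lt_irrefl _ h1
      exact ⟨(boxLT_total T hne).resolve_right h2, not_lt.2 h1.le⟩

/-- The labelling of the boxes of `s` with `q`-exponents `T` that gives the box `e j` the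
number `j + 1`. -/
noncomputable def labelling {s : Finset (ℕ × ℕ)} (T : ℕ × ℕ → ℕ) (e : Fin s.card ≃ s) :
    ℕ × ℕ → ℕ × ℕ :=
  fun c => if h : c ∈ s then ((e.symm ⟨c, h⟩ : ℕ) + 1, T c) else (0, 0)

section labelling

variable {s : Finset (ℕ × ℕ)} {T : ℕ × ℕ → ℕ}

theorem labelling_apply (e : Fin s.card ≃ s) {c : ℕ × ℕ} (hc : c ∈ s) :
    labelling T e c = ((e.symm ⟨c, hc⟩ : ℕ) + 1, T c) := dif_pos hc

theorem labelling_coe (e : Fin s.card ≃ s) (j : Fin s.card) :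
    labelling T e (e j) = ((j : ℕ) + 1, T (e j)) := by
  simp [labelling_apply e (e j).2]

theorem labelling_injective : Function.Injective (labelling (s := s) T) := by
  intro e e' h
  refine Equiv.symm_bijective.injective (Equiv.ext fun c => Fin.ext ?_)
  have := congrFun h c
  rw [labelling_apply e c.2, labelling_apply e' c.2] at this
  simpa using this

theorem labelling_injOn (e : Fin s.card ≃ s) : Set.InjOn (fun c => (labelling T e c).1) s := by
  intro c hc c' hc' h
  simp only [labelling_apply e hc, labelling_apply e hc', add_left_inj] at h
  simpa using e.symm.injective (Fin.ext h)

theorem InFiber.mem_range_labelling {τ : ℕ × ℕ → ℕ × ℕ} (hτ : InFiber s T τ) :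
    τ ∈ Set.range (labelling (s := s) T) := by
  choose f hf _ using fun j : Fin s.card => hτ.1.1 (j + 1) (by omega) (by omega)
  have hinj : Function.Injective fun j => (⟨f j, (hf j).1⟩ : s) := by
    intro i j h
    have h1 : f i = f j := by simpa using h
    have h2 := (hf i).2
    rw [h1, (hf j).2] at h2
    exact Fin.ext (by omega)
  have hbij := (Fintype.bijective_iff_injective_and_card _).2 ⟨hinj, by simp⟩
  refine ⟨Equiv.ofBijective _ hbij, funext fun c => ?_⟩
  by_cases hc : c ∈ s
  · obtain ⟨j, hj⟩ := hbij.2 ⟨c, hc⟩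
    have hj' : f j = c := by simpa using hj
    have := labelling_coe (T := T) (Equiv.ofBijective _ hbij) j
    simp only [Equiv.ofBijective_apply, hj'] at this
    rw [this, ← hτ.2 c hc, ← (hf j).2, hj']
  · rw [hτ.1.2.2.2 c hc, labelling, dif_neg hc]

theorem exists_inversion_of_not_inFiber (hT : IsRSSYT s T) (e : Fin s.card ≃ s)
    (h : ¬ InFiber s T (labelling T e)) :
    ∃ p ∈ invSet s T (labelling T e), T p.1 = T p.2 ∧ content p.2 = content p.1 + 1 := by
  contrapose! h
  refine ⟨⟨fun j h1 h2 => ?_, fun c hc c' hc' h1 h2 => ?_, fun c hc c' hc' h1 h2 => ?_,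
    fun c hc => dif_neg hc⟩, fun c hc => by rw [labelling_apply e hc]⟩
  · refine ⟨e ⟨j - 1, by omega⟩, ⟨(e _).2, ?_⟩, ?_⟩
    · rw [labelling_coe]
      simp only
      omega
    · rintro c ⟨hc, hj⟩
      refine labelling_injOn (T := T) e hc (e _).2 ?_
      simp only [labelling_coe, hj]
      omega
  · have hle := hT.1 c hc c' hc' h1 h2
    have hinv := h (c, c')
    have hne : (labelling T e c).1 ≠ (labelling T e c').1 := fun h3 => by
      rw [labelling_injOn e hc hc' h3] at h2
      omega
    have e1 : (labelling T e c).2 = T c := by rw [labelling_apply e hc]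
    have e2 : (labelling T e c').2 = T c' := by rw [labelling_apply e hc']
    simp only [labelLT, e1, e2]
    by_contra hlab
    refine hinv (Finset.mem_filter.2 ⟨Finset.mem_product.2 ⟨hc, hc'⟩, Or.inr ⟨?_, Or.inl ?_⟩, ?_⟩)
      ?_ ?_ <;> simp only [content] <;> omega
  · have := hT.2.1 c hc c' hc' h1 h2
    rw [labelling_apply e hc, labelling_apply e hc']
    exact Or.inl this

theorem prod_labelling_lt {M : Type*} [CommMonoid M] (e : Fin s.card ≃ s)
    (g : ℕ × ℕ → ℕ × ℕ → M) :
    ∏ p ∈ (s ×ˢ s).filter fun p => (labelling T e p.1).1 < (labelling T e p.2).1, g p.1 p.2 =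
      ∏ i, ∏ j ∈ Finset.Ioi i, g (e i) (e j) := by
  rw [Finset.prod_filter, Finset.prod_product, ← Finset.prod_coe_sort, ← Equiv.prod_comp e]
  refine Finset.prod_congr rfl fun i _ => ?_
  rw [← Finset.prod_coe_sort, ← Equiv.prod_comp e, ← Finset.filter_lt_eq_Ioi, Finset.prod_filter]
  refine Finset.prod_congr rfl fun j _ => ?_
  simp only [labelling_coe, add_lt_add_iff_right, Fin.val_fin_lt]

end labelling

theorem mul_one_sub_div_eq_boxWeight {F : Type*} [Field F] {q t : F} (hq : q ≠ 0) (ht : t ≠ 0)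
    (T : ℕ × ℕ → ℕ) (c c' : ℕ × ℕ) :
    t * ((1 - q ^ ((T c' : ℤ) - (T c : ℤ)) * t ^ (content c' - content c - 1)) /
        (1 - q ^ ((T c' : ℤ) - (T c : ℤ)) * t ^ (content c' - content c + 1))) =
      (t * boxWeight q t T c - boxWeight q t T c') /
        (boxWeight q t T c - t * boxWeight q t T c') := by
  have hc : boxWeight q t T c ≠ 0 := boxWeight_ne_zero hq ht c
  have hratio : q ^ ((T c' : ℤ) - (T c : ℤ)) * t ^ (content c' - content c) =
      boxWeight q t T c' / boxWeight q t T c := by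
    rw [zpow_sub₀ hq, zpow_sub₀ ht, zpow_natCast, zpow_natCast, boxWeight, boxWeight,
      mul_div_mul_comm]
  rw [zpow_sub_one₀ ht, zpow_add_one₀ ht, ← mul_assoc, ← mul_assoc, hratio, ← mul_div_assoc,
    ← mul_div_mul_right _ (1 - _) hc]
  congr 1 <;> field_simp

theorem IsRSSYT.inv_Kcoef_eq {F : Type*} [Field F] {q t : F} (hq : q ≠ 0) (ht : t ≠ 0)
    (hqt : ∀ a b : ℤ, q ^ a * t ^ b = 1 → a = 0 ∧ b = 0) {μ : YoungDiagram} {T : ℕ × ℕ → ℕ}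
    (hT : IsRSSYT μ.cells T) :
    (Kcoef q t μ.cells T)⁻¹ =
      ∑ᶠ τ ∈ {τ : ℕ × ℕ → ℕ × ℕ | InFiber μ.cells T τ},
        t ^ invNum μ.cells T τ *
          ∏ p ∈ invSet μ.cells T τ,
            (1 - q ^ ((T p.2 : ℤ) - (T p.1 : ℤ)) * t ^ (content p.2 - content p.1 - 1)) /
              (1 - q ^ ((T p.2 : ℤ) - (T p.1 : ℤ)) * t ^ (content p.2 - content p.1 + 1)) := by
  set s := μ.cells
  set z := boxWeight q t T
  have ht1 : ∀ k : ℕ, 0 < k → t ^ k ≠ 1 := fun k hk h => by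
    have := (hqt 0 k (by simpa using h)).2
    omega
  have ht1' : t ≠ 1 := by simpa using ht1 1 one_pos
  have hfact : tFact t s.card ≠ 0 := Finset.prod_ne_zero_iff.2 fun k hk =>
    div_ne_zero (sub_ne_zero.2 (ht1 k (Finset.mem_Icc.1 hk).1).symm) (sub_ne_zero.2 ht1'.symm)
  have hzinj : Set.InjOn z s := hT.boxWeight_injOn hq ht hqt
  have hzsub : ∀ c ∈ s, ∀ c' ∈ s, boxLT T c c' → z c - t * z c' ≠ 0 := fun c _ c' hc' h =>
    hT.boxWeight_sub_ne_zero hq ht hqt hc' h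
  have hterm : ∀ τ : ℕ × ℕ → ℕ × ℕ, t ^ invNum s T τ *
      ∏ p ∈ invSet s T τ,
        (1 - q ^ ((T p.2 : ℤ) - (T p.1 : ℤ)) * t ^ (content p.2 - content p.1 - 1)) /
          (1 - q ^ ((T p.2 : ℤ) - (T p.1 : ℤ)) * t ^ (content p.2 - content p.1 + 1)) =
      ∏ p ∈ invSet s T τ, (t * z p.1 - z p.2) / (z p.1 - t * z p.2) := fun τ => by
    rw [invNum, ← Finset.prod_const, ← Finset.prod_mul_distrib]
    exact Finset.prod_congr rfl fun p _ => mul_one_sub_div_eq_boxWeight hq ht T p.1 p.2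
  simp only [hterm]
  set D := ∏ p ∈ (s ×ˢ s).filter fun p => boxLT T p.1 p.2, (z p.1 - t * z p.2) / (z p.1 - z p.2)
  have hD : D ≠ 0 := Finset.prod_ne_zero_iff.2 fun p hp => by
    simp only [Finset.mem_filter, Finset.mem_product] at hp
    refine div_ne_zero (hzsub _ hp.1.1 _ hp.1.2 hp.2) (sub_ne_zero.2 fun h => ?_)
    have h1 := hp.2
    rw [hzinj hp.1.1 hp.1.2 h] at h1
    exact boxLT_irrefl _ _ h1
  have e₀ : Fin s.card ≃ s := s.equivFin.symm
  have hinj : Function.Injective fun σ : Equiv.Perm (Fin s.card) => labelling T (σ.trans e₀) :=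
    fun σ σ' h => Equiv.ext fun i => e₀.injective (Equiv.congr_fun (labelling_injective h) i)
  have hsum : ∑ᶠ τ ∈ {τ : ℕ × ℕ → ℕ × ℕ | InFiber s T τ},
      ∏ p ∈ invSet s T τ, (t * z p.1 - z p.2) / (z p.1 - t * z p.2) =
      ∑ σ : Equiv.Perm (Fin s.card), ∏ p ∈ invSet s T (labelling T (σ.trans e₀)),
        (t * z p.1 - z p.2) / (z p.1 - t * z p.2) := by
    rw [← finsum_eq_sum_of_fintype, ← finsum_mem_range hinj (f := fun τ => ∏ p ∈ invSet s T τ,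
      (t * z p.1 - z p.2) / (z p.1 - t * z p.2))]
    refine finsum_mem_inter_support_eq _ _ _ (Set.ext fun τ => and_congr_left fun hτ => ?_)
    constructor
    · intro h
      obtain ⟨e, rfl⟩ := InFiber.mem_range_labelling h
      exact ⟨e.trans e₀.symm, by simp [Equiv.trans_assoc]⟩
    · rintro ⟨σ, rfl⟩
      by_contra h
      obtain ⟨p, hp, h1, h2⟩ := exists_inversion_of_not_inFiber hT _ h
      refine hτ (Finset.prod_eq_zero hp ?_)
      have : z p.2 = t * z p.1 := by
        simp only [z, boxWeight, h1, h2, zpow_add_one₀ ht]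
        ring
      rw [this, sub_self, zero_div]
  have hsumD : (∑ σ : Equiv.Perm (Fin s.card), ∏ p ∈ invSet s T (labelling T (σ.trans e₀)),
      (t * z p.1 - z p.2) / (z p.1 - t * z p.2)) * D = tFact t s.card := by
    rw [← sum_perm_prod_sub_mul_div_sub ht1' s.card (z := fun i => z (e₀ i))
      (fun i j h => e₀.injective (Subtype.ext (hzinj (e₀ i).2 (e₀ j).2 h)))
      (fun i => boxWeight_ne_zero hq ht _), Finset.sum_mul]
    refine Finset.sum_congr rfl fun σ _ => ?_
    rw [prod_invSet_mul_prod_boxLT (labelling_injOn _) hzsub,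
      prod_labelling_lt _ fun c c' => (z c - t * z c') / (z c - z c')]
    rfl
  have hK : Kcoef q t s T * tFact t s.card = D := hT.Kcoef_mul_tFact hq ht hqt hfact
  rw [hsum]
  refine inv_eq_of_mul_eq_one_right (mul_right_cancel₀ hfact ?_)
  rw [one_mul, mul_right_comm, hK, mul_comm, hsumD]

theorem qParam_ne_zero : qParam ≠ 0 := by
  simp [qParam]

theorem tParam_ne_zero : tParam ≠ 0 := by
  simp [tParam]

theorem qParam_pow_mul_tParam_pow_injective {a b c d : ℕ}
    (h : qParam ^ a * tParam ^ b = qParam ^ c * tParam ^ d) : a = c ∧ b = d := by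
  have h1 : (MvPolynomial.X 0 ^ a * MvPolynomial.X 1 ^ b : MvPolynomial (Fin 2) ℚ) =
      MvPolynomial.X 0 ^ c * MvPolynomial.X 1 ^ d :=
    IsFractionRing.injective (MvPolynomial (Fin 2) ℚ) QQt (by simpa [qParam, tParam] using h)
  rw [MvPolynomial.X_pow_eq_monomial, MvPolynomial.X_pow_eq_monomial,
    MvPolynomial.X_pow_eq_monomial, MvPolynomial.X_pow_eq_monomial, MvPolynomial.monomial_mul,
    MvPolynomial.monomial_mul, one_mul, MvPolynomial.monomial_left_inj one_ne_zero] at h1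
  exact ⟨by simpa using DFunLike.congr_fun h1 0, by simpa using DFunLike.congr_fun h1 1⟩

theorem qParam_zpow_mul_tParam_zpow_eq_one (a b : ℤ) (h : qParam ^ a * tParam ^ b = 1) :
    a = 0 ∧ b = 0 := by
  have hq := qParam_ne_zero
  have ht := tParam_ne_zero
  have key := qParam_pow_mul_tParam_pow_injective (a := a.toNat) (b := b.toNat)
    (c := (-a).toNat) (d := (-b).toNat) ?_
  · omega
  · rw [← Int.toNat_sub_toNat_neg a, ← Int.toNat_sub_toNat_neg b, zpow_sub₀ hq, zpow_sub₀ ht,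
      div_mul_div_comm, div_eq_one_iff_eq (mul_ne_zero (zpow_ne_zero _ hq) (zpow_ne_zero _ ht))]
      at h
    exact_mod_cast h

/-- Let `λ` be a partition of `n` and `T ∈ RSSYT(λ)`. Then in `ℚ(q,t)`:
`1/K_T(q,t) = Σ_{τ ∈ PSYT(λ;T)} t^{inv(τ)} ·
Π_{(□₁,□₂) ∈ Inv(τ)} (1 − q^{T□₂−T□₁} t^{c□₂−c□₁−1})/(1 − q^{T□₂−T□₁} t^{c□₂−c□₁+1})`. -/
theorem statement13 (μ : YoungDiagram) (n : ℕ) (hn : μ.card = n)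
    (T : ℕ × ℕ → ℕ) (hT : IsRSSYT μ.cells T) :
    (Kcoef qParam tParam μ.cells T)⁻¹ =
      ∑ᶠ τ ∈ {τ : ℕ × ℕ → ℕ × ℕ | InFiber μ.cells T τ},
        tParam ^ invNum μ.cells T τ *
          ∏ p ∈ invSet μ.cells T τ,
            (1 - qParam ^ ((T p.2 : ℤ) - (T p.1 : ℤ)) *
                tParam ^ (content p.2 - content p.1 - 1)) /
              (1 - qParam ^ ((T p.2 : ℤ) - (T p.1 : ℤ)) *
                tParam ^ (content p.2 - content p.1 + 1)) := by
  exact hT.inv_Kcoef_eq qParam_ne_zero tParam_ne_zero qParam_zpow_mul_tParam_zpow_eq_one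
end

section
/- Let λ be a partition and T ∈ Ω(λ). For each n ≥ n_λ the restriction T|_{λ^{(n)}} lies in RSSYT(λ^{(n)}); regard K_{T|_{λ^{(n)}}}(q,t) ∈ ℚ(q,t) as an element of K = ℚ(q)((t)). Then as n → ∞ the sequence (K_{T|_{λ^{(n)}}}(q,t))_{n ≥ n_λ} converges in the t-adic topology of K to ((1−t)^{rk(T)} · [μ(T|_{λ^{(rk(T))}})]_t! / Π_{□ ∈ λ^{(rk(T))}} (1 − q^{−T(□)} t^{rk(T)−|λ|−c(□)})) · Π_{(□_1,□_2) ∈ I(T|_{λ^{(rk(T))}})} (1 − q^{T(□_2)−T(□_1)} t^{c(□_2)−c(□_1)+1})/(1 − q^{T(□_2)−T(□_1)} t^{c(□_2)−c(□_1)}). -/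
open scoped Classical

/-- Membership in the infinite diagram `λ^{(∞)}`: an infinite first row atop a copy of
the partition `λ` shifted down by one row. -/
def cellInf (μ : YoungDiagram) : ℕ × ℕ → Prop
  | (0, _) => True
  | (i + 1, j) => (i, j) ∈ μ

/-- Membership in the padded partition `λ^{(n)} = (n − |λ|, λ₁, …, λ_r)`. -/
def cellN (μ : YoungDiagram) (n : ℕ) : ℕ × ℕ → Prop
  | (0, j) => j < n - μ.card
  | (i + 1, j) => (i, j) ∈ μ

/-- `n_λ := |λ| + λ₁`. -/
def nLam (μ : YoungDiagram) : ℕ := μ.card + μ.rowLen 0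

/-- `T ∈ Ω(λ)`: a labelling of `λ^{(∞)}` by non-negative integers, with finitely many
nonzero values, weakly decreasing along rows and strictly decreasing down columns
(normalized to `0` off `λ^{(∞)}`). -/
def IsOmega (μ : YoungDiagram) (T : ℕ × ℕ → ℕ) : Prop :=
  (∀ c, ¬ cellInf μ c → T c = 0) ∧
  {c : ℕ × ℕ | T c ≠ 0}.Finite ∧
  (∀ c : ℕ × ℕ, cellInf μ c → cellInf μ (c.1, c.2 + 1) → T (c.1, c.2 + 1) ≤ T c) ∧
  (∀ c : ℕ × ℕ, cellInf μ c → cellInf μ (c.1 + 1, c.2) → T (c.1 + 1, c.2) < T c)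

/-- The degree `deg(T) = Σ_{□ ∈ λ^{(∞)}} T(□)`. -/
noncomputable def degOmega (T : ℕ × ℕ → ℕ) : ℕ := ∑ᶠ c, T c

/-- The rank `rk(T)`: the least `n ≥ n_λ` such that `T` vanishes on `λ^{(∞)} ∖ λ^{(n)}`. -/
noncomputable def rkOmega (μ : YoungDiagram) (T : ℕ × ℕ → ℕ) : ℕ :=
  sInf {n | nLam μ ≤ n ∧ ∀ c, cellInf μ c → ¬ cellN μ n c → T c = 0}

/-- The cell set of the padded partition `λ^{(m)} = (m − |λ|, λ₁, …, λ_r)`. -/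
def hatCells (μ : YoungDiagram) (m : ℕ) : Finset (ℕ × ℕ) :=
  ((Finset.range (m - μ.card)).image fun j => (0, j)) ∪
    (μ.cells.image fun c => (c.1 + 1, c.2))

/-- The restriction `T|_{λ^{(n)}}` of a labelling of `λ^{(∞)}` (normalized to `0` off
`λ^{(n)}`). -/
noncomputable def restLam (μ : YoungDiagram) (n : ℕ) (T : ℕ × ℕ → ℕ) : ℕ × ℕ → ℕ :=
  fun c => if cellN μ n c then T c else 0

/-- The field `K = ℚ(q)((t))` of formal Laurent series in `t` over `ℚ(q)`. -/
abbrev LK : Type := LaurentSeries (RatFunc ℚ)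

/-- The element `q` of `K = ℚ(q)((t))`. -/
noncomputable def qL : LK := HahnSeries.C (RatFunc.X : RatFunc ℚ)

/-- The element `t` of `K = ℚ(q)((t))`. -/
noncomputable def tL : LK := HahnSeries.single (1 : ℤ) (1 : RatFunc ℚ)

section Diagram

variable {μ : YoungDiagram} {T : ℕ × ℕ → ℕ} {n : ℕ}

theorem mem_hatCells {c : ℕ × ℕ} : c ∈ hatCells μ n ↔ cellN μ n c := by
  obtain ⟨i, j⟩ := c
  cases i <;> simp [hatCells, cellN]

theorem cellInf_of_cellN {c : ℕ × ℕ} (h : cellN μ n c) : cellInf μ c := by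
  obtain ⟨i, j⟩ := c
  cases i
  · trivial
  · exact h

theorem isRSSYT_restLam (hT : IsOmega μ T) : IsRSSYT (hatCells μ n) (restLam μ n T) := by
  obtain ⟨-, -, hrow, hcol⟩ := hT
  refine ⟨?_, ?_, fun c hc => ?_⟩
  · rintro ⟨i, j⟩ hc ⟨i', j'⟩ hc' rfl rfl
    rw [mem_hatCells] at hc hc'
    simpa [restLam, hc, hc'] using hrow (i, j) (cellInf_of_cellN hc) (cellInf_of_cellN hc')
  · rintro ⟨i, j⟩ hc ⟨i', j'⟩ hc' rfl rfl
    rw [mem_hatCells] at hc hc'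
    simpa [restLam, hc, hc'] using hcol (i, j) (cellInf_of_cellN hc) (cellInf_of_cellN hc')
  · rw [mem_hatCells] at hc
    simp [restLam, hc]

theorem rkOmega_spec (hT : IsOmega μ T) :
    nLam μ ≤ rkOmega μ T ∧ ∀ c, cellInf μ c → ¬ cellN μ (rkOmega μ T) c → T c = 0 := by
  obtain ⟨-, hfin, -, -⟩ := hT
  refine Nat.sInf_mem
    (s := {n | nLam μ ≤ n ∧ ∀ c, cellInf μ c → ¬ cellN μ n c → T c = 0}) ?_
  obtain ⟨B, hB⟩ := (hfin.image Prod.snd).bddAbove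
  refine ⟨nLam μ + μ.card + B + 1, by omega, ?_⟩
  rintro ⟨i, j⟩ hc hn
  by_contra h
  have hj : j ≤ B := hB ⟨(i, j), h, rfl⟩
  cases i
  · simp only [cellN] at hn
    omega
  · exact hn hc

theorem eq_zero_of_not_cellN_rkOmega (hT : IsOmega μ T) {c : ℕ × ℕ}
    (hc : ¬ cellN μ (rkOmega μ T) c) : T c = 0 := by
  by_cases h : cellInf μ c
  · exact (rkOmega_spec hT).2 c h hc
  · exact hT.1 c h

theorem cellN_mono {m : ℕ} (hmn : m ≤ n) {c : ℕ × ℕ} (hc : cellN μ m c) : cellN μ n c := by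
  obtain ⟨i, j⟩ := c
  cases i
  · simp only [cellN] at hc ⊢
    omega
  · exact hc

theorem restLam_eq_self (hT : IsOmega μ T) (hn : rkOmega μ T ≤ n) : restLam μ n T = T := by
  funext c
  unfold restLam
  split_ifs with h
  · rfl
  · exact (eq_zero_of_not_cellN_rkOmega hT fun h' => h (cellN_mono hn h')).symm

theorem snd_lt_of_mem_hatCells (hn : nLam μ ≤ n) {c : ℕ × ℕ} (hc : c ∈ hatCells μ n) :
    c.2 < n - μ.card := by
  obtain ⟨i, j⟩ := c
  rw [mem_hatCells] at hc
  cases i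
  · exact hc
  · rename_i i
    have h1 := YoungDiagram.mem_iff_lt_rowLen.1 (show (i, j) ∈ μ from hc)
    have h2 := μ.rowLen_anti 0 i (Nat.zero_le _)
    simp only [nLam] at hn
    show j < _
    omega

/-- The boxes of the first row with column index in `[a, b)`. -/
def firstRow (a b : ℕ) : Finset (ℕ × ℕ) := (Finset.Ico a b).image fun j => (0, j)

theorem mem_firstRow {a b : ℕ} {c : ℕ × ℕ} : c ∈ firstRow a b ↔ c.1 = 0 ∧ a ≤ c.2 ∧ c.2 < b := by
  obtain ⟨i, j⟩ := c
  simp [firstRow, and_comm, eq_comm]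

theorem prod_firstRow {F : Type*} [CommMonoid F] (a b : ℕ) (f : ℕ × ℕ → F) :
    ∏ c ∈ firstRow a b, f c = ∏ j ∈ Finset.Ico a b, f (0, j) :=
  Finset.prod_image fun _ _ _ _ h => (Prod.mk.inj h).2

theorem hatCells_eq_union {m : ℕ} (hmn : m ≤ n) :
    hatCells μ n = hatCells μ m ∪ firstRow (m - μ.card) (n - μ.card) := by
  ext ⟨i, j⟩
  rw [Finset.mem_union, mem_hatCells, mem_hatCells, mem_firstRow]
  cases i <;> simp [cellN]
  omega

theorem disjoint_hatCells_firstRow (m b : ℕ) :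
    Disjoint (hatCells μ m) (firstRow (m - μ.card) b) := by
  rw [Finset.disjoint_left]
  rintro ⟨i, j⟩ h h'
  rw [mem_hatCells] at h
  obtain ⟨rfl, h', -⟩ := mem_firstRow.1 h'
  simp only [cellN] at h
  omega

theorem card_hatCells (hn : μ.card ≤ n) : (hatCells μ n).card = n := by
  unfold hatCells
  rw [Finset.card_union_of_disjoint, Finset.card_image_of_injective,
    Finset.card_image_of_injective, Finset.card_range]
  · exact Nat.sub_add_cancel hn
  · rintro ⟨i, j⟩ ⟨i', j'⟩ h
    simpa using h
  · intro i j h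
    simpa using h
  · rw [Finset.disjoint_left]
    simp

end Diagram

section Inversions

theorem mem_invSet_minTab {s : Finset (ℕ × ℕ)} {T : ℕ × ℕ → ℕ} {p : (ℕ × ℕ) × (ℕ × ℕ)} :
    p ∈ invSet s T (minTab s T) ↔ (p.1 ∈ s ∧ p.2 ∈ s) ∧
      (T p.2 < T p.1 ∨ T p.1 = T p.2 ∧ p.1.2 < p.2.2 ∧ p.2.1 < p.1.1) := by
  rw [invSet, Finset.mem_filter, Finset.mem_product]
  refine and_congr_right fun h => ?_
  rw [minTab_lt_iff h.2 h.1]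
  simp only [boxLT, minOrd, rowReadLT, colReadLT]
  omega

variable {μ : YoungDiagram} {T : ℕ × ℕ → ℕ} {n : ℕ}

theorem firstRow_eq_zero (hT : IsOmega μ T) {b : ℕ} {c : ℕ × ℕ}
    (hc : c ∈ firstRow (rkOmega μ T - μ.card) b) : T c = 0 := by
  refine eq_zero_of_not_cellN_rkOmega hT fun h => ?_
  exact Finset.disjoint_left.1 (disjoint_hatCells_firstRow _ _) (mem_hatCells.2 h) hc

/-- The boxes of `λ^{(rk T)}` other than the zero boxes of its first row. -/
noncomputable def activeCells (μ : YoungDiagram) (T : ℕ × ℕ → ℕ) : Finset (ℕ × ℕ) :=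
  (hatCells μ (rkOmega μ T)).filter fun c => 0 < T c ∨ 0 < c.1

theorem invSet_hatCells (hT : IsOmega μ T) (hn : rkOmega μ T ≤ n) :
    invSet (hatCells μ n) T (minTab (hatCells μ n) T) =
      invSet (hatCells μ (rkOmega μ T)) T (minTab (hatCells μ (rkOmega μ T)) T) ∪
        activeCells μ T ×ˢ firstRow (rkOmega μ T - μ.card) (n - μ.card) := by
  ext ⟨c, c'⟩
  rw [Finset.mem_union, mem_invSet_minTab, mem_invSet_minTab, Finset.mem_product, activeCells,
    Finset.mem_filter, hatCells_eq_union hn, Finset.mem_union, Finset.mem_union]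
  dsimp only
  have h1 := fun h => firstRow_eq_zero hT (b := n - μ.card) (c := c) h
  have h2 := fun h => firstRow_eq_zero hT (b := n - μ.card) (c := c') h
  have h3 := fun h => snd_lt_of_mem_hatCells (rkOmega_spec hT).1 (c := c) h
  have h4 := (mem_firstRow (a := rkOmega μ T - μ.card) (b := n - μ.card) (c := c)).1
  have h5 := (mem_firstRow (a := rkOmega μ T - μ.card) (b := n - μ.card) (c := c')).1
  constructor
  · rintro ⟨⟨hc | hc, hc' | hc'⟩, h⟩
    · exact Or.inl ⟨⟨hc, hc'⟩, h⟩
    · refine Or.inr ⟨⟨hc, ?_⟩, hc'⟩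
      have := h2 hc'
      omega
    all_goals
      have := h1 hc
      have := h4 hc
      omega
  · rintro (⟨⟨hc, hc'⟩, h⟩ | ⟨⟨hc, h⟩, hc'⟩)
    · exact ⟨⟨Or.inl hc, Or.inl hc'⟩, h⟩
    · refine ⟨⟨Or.inl hc, Or.inr hc'⟩, ?_⟩
      have := h2 hc'
      have := h3 hc
      have := h5 hc'
      omega

theorem disjoint_invSet_product (m b : ℕ) (s : Finset (ℕ × ℕ)) :
    Disjoint (invSet (hatCells μ m) T (minTab (hatCells μ m) T))
      (s ×ˢ firstRow (m - μ.card) b) := by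
  rw [Finset.disjoint_left]
  intro p h h'
  exact Finset.disjoint_left.1 (disjoint_hatCells_firstRow _ _) (mem_invSet_minTab.1 h).1.2
    (Finset.mem_product.1 h').2

end Inversions

section Runs

variable {μ : YoungDiagram} {T : ℕ × ℕ → ℕ} {n : ℕ}

/-- The column of the first zero box in the first row. -/
noncomputable def zeroCol (T : ℕ × ℕ → ℕ) : ℕ := sInf {j | T (0, j) = 0}

theorem firstRow_antitone (hT : IsOmega μ T) : Antitone fun j => T (0, j) :=
  antitone_nat_of_succ_le fun j => hT.2.2.1 (0, j) trivial trivial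

theorem apply_rkOmega_sub_card (hT : IsOmega μ T) : T (0, rkOmega μ T - μ.card) = 0 :=
  eq_zero_of_not_cellN_rkOmega hT (by simp [cellN])

theorem zeroCol_le (hT : IsOmega μ T) : zeroCol T ≤ rkOmega μ T - μ.card :=
  Nat.sInf_le (apply_rkOmega_sub_card hT)

theorem apply_firstRow_eq_zero_iff (hT : IsOmega μ T) {j : ℕ} :
    T (0, j) = 0 ↔ zeroCol T ≤ j := by
  refine ⟨fun h => Nat.sInf_le h, fun h => ?_⟩
  have h0 : T (0, zeroCol T) = 0 :=
    Nat.sInf_mem (s := {j | T (0, j) = 0}) ⟨_, apply_rkOmega_sub_card hT⟩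
  exact Nat.le_zero.1 ((firstRow_antitone hT h).trans h0.le)

theorem runPos_firstRow (hT : IsOmega μ T) {j : ℕ} (hj : zeroCol T ≤ j) (hjn : j < n - μ.card) :
    runPos (hatCells μ n) T (0, j) = j - zeroCol T + 1 := by
  have : ((Finset.range (j + 1)).filter fun l => ∀ m, l ≤ m → m ≤ j →
      ((0, m) ∈ hatCells μ n ∧ T (0, m) = T (0, j))) = Finset.Icc (zeroCol T) j := by
    ext l
    rw [Finset.mem_filter, Finset.mem_range, Finset.mem_Icc,
      (apply_firstRow_eq_zero_iff hT).2 hj]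
    simp only [apply_firstRow_eq_zero_iff hT, mem_hatCells, cellN]
    constructor
    · rintro ⟨h, h'⟩
      exact ⟨(h' l le_rfl (by omega)).2, by omega⟩
    · rintro ⟨h, h'⟩
      exact ⟨by omega, fun m hm hm' => by omega⟩
  simp only [runPos]
  rw [this, Nat.card_Icc]
  omega

theorem runPos_hatCells {m : ℕ} (hmn : m ≤ n) {c : ℕ × ℕ} (hc : c ∈ hatCells μ m) :
    runPos (hatCells μ n) T c = runPos (hatCells μ m) T c := by
  unfold runPos
  congr 1
  refine Finset.filter_congr fun l _ => forall_congr' fun k => imp_congr_right fun _ =>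
    imp_congr_right fun hk => and_congr_left fun _ => ?_
  obtain ⟨i, j⟩ := c
  rw [mem_hatCells] at hc
  rw [mem_hatCells, mem_hatCells]
  cases i
  · simp only [cellN] at hc hk ⊢
    omega
  · exact Iff.rfl

end Runs

section Field

variable {F : Type*} [Field F]

/-- The `t`-Pochhammer product `Π_{i=1}^m (1 − t^i)`. -/
def tPoch (t : F) (m : ℕ) : F := ∏ i ∈ Finset.range m, (1 - t ^ (i + 1))

theorem tFact_eq (t : F) (m : ℕ) : tFact t m = tPoch t m / (1 - t) ^ m := by
  rw [tFact, tPoch, Finset.prod_div_distrib, Finset.prod_const, Nat.card_Icc,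
    ← Finset.Ico_add_one_right_eq_Icc, Finset.prod_Ico_eq_prod_range]
  simp [add_comm]

theorem tPoch_add (t : F) (m k : ℕ) :
    tPoch t (m + k) = tPoch t m * ∏ i ∈ Finset.range k, (1 - t ^ (m + i + 1)) :=
  Finset.prod_range_add _ _ _

theorem sub_div_sub_eq {x : F} (hx : x ≠ 0) (y z : F) :
    (x - y) / (x - z) = (1 - y / x) / (1 - z / x) := by
  rw [← mul_div_mul_left (1 - y / x) _ hx, mul_sub, mul_sub, mul_one, mul_div_cancel₀ _ hx,
    mul_div_cancel₀ _ hx]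

theorem inversion_factor_eq {q t : F} (hq : q ≠ 0) (ht : t ≠ 0) (a b : ℕ) (x y z : ℤ) :
    (q ^ a * t ^ x - q ^ b * t ^ y) / (q ^ a * t ^ x - q ^ b * t ^ z) =
      (1 - q ^ ((b : ℤ) - a) * t ^ (y - x)) / (1 - q ^ ((b : ℤ) - a) * t ^ (z - x)) := by
  rw [sub_div_sub_eq (mul_ne_zero (pow_ne_zero _ hq) (zpow_ne_zero _ ht)),
    mul_div_mul_comm, mul_div_mul_comm, zpow_sub₀ hq, zpow_sub₀ ht, zpow_sub₀ ht, zpow_natCast,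
    zpow_natCast]

theorem prod_Ico_div_of_ne_zero {f : ℕ → F} {a b : ℕ} (hab : a ≤ b)
    (hf : ∀ j, a ≤ j → f j ≠ 0) : ∏ j ∈ Finset.Ico a b, f (j + 1) / f j = f b / f a := by
  induction b, hab using Nat.le_induction with
  | base => simp [hf a le_rfl]
  | succ b hab ih =>
    rw [Finset.prod_Ico_succ_top hab, ih, mul_comm, div_mul_div_cancel₀ (hf b hab)]

variable {μ : YoungDiagram} {T : ℕ × ℕ → ℕ} {n : ℕ} {q t : F}

theorem muFact_hatCells (hT : IsOmega μ T) (hn : rkOmega μ T ≤ n)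
    (hne : ∀ (m k : ℤ), 0 < k → 1 - q ^ m * t ^ k ≠ 0) :
    muFact t (hatCells μ n) T * tPoch t (rkOmega μ T - μ.card - zeroCol T) *
        (1 - t) ^ (n - rkOmega μ T) =
      muFact t (hatCells μ (rkOmega μ T)) T * tPoch t (n - μ.card - zeroCol T) := by
  have h1t : (1 - t : F) ≠ 0 := by simpa using hne 0 1 one_pos
  have hr := (rkOmega_spec hT).1
  have hz := zeroCol_le hT
  have hcard : μ.card ≤ rkOmega μ T := (Nat.le_add_right _ _).trans hr
  have hsplit : muFact t (hatCells μ n) T = muFact t (hatCells μ (rkOmega μ T)) T *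
      ∏ c ∈ firstRow (rkOmega μ T - μ.card) (n - μ.card),
        (1 - t ^ runPos (hatCells μ n) T c) / (1 - t) := by
    rw [muFact, muFact]
    conv_lhs => rw [hatCells_eq_union hn]
    rw [Finset.prod_union (disjoint_hatCells_firstRow _ _), ← hatCells_eq_union hn]
    congr 1
    exact Finset.prod_congr rfl fun c hc => by rw [runPos_hatCells hn hc]
  have hrow : ∏ c ∈ firstRow (rkOmega μ T - μ.card) (n - μ.card),
        (1 - t ^ runPos (hatCells μ n) T c) / (1 - t) =
      (∏ i ∈ Finset.range (n - rkOmega μ T),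
        (1 - t ^ (rkOmega μ T - μ.card - zeroCol T + i + 1))) /
        (1 - t) ^ (n - rkOmega μ T) := by
    have hlen : n - μ.card - (rkOmega μ T - μ.card) = n - rkOmega μ T := by omega
    rw [prod_firstRow, Finset.prod_Ico_eq_prod_range, hlen, Finset.prod_div_distrib,
      Finset.prod_const, Finset.card_range]
    congr 1
    refine Finset.prod_congr rfl fun i hi => ?_
    rw [Finset.mem_range] at hi
    rw [runPos_firstRow hT (by omega) (by omega)]
    congr 3
    omega
  have hsum : n - μ.card - zeroCol T =
      rkOmega μ T - μ.card - zeroCol T + (n - rkOmega μ T) := by omega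
  rw [hsplit, hrow, hsum, tPoch_add]
  field_simp

theorem prod_invSet_hatCells (hT : IsOmega μ T) (hn : rkOmega μ T ≤ n) (hq : q ≠ 0) (ht : t ≠ 0)
    (hne : ∀ (m k : ℤ), 0 < k → 1 - q ^ m * t ^ k ≠ 0) :
    ∏ p ∈ invSet (hatCells μ n) T (minTab (hatCells μ n) T),
      (q ^ T p.1 * t ^ content p.1 - q ^ T p.2 * t ^ (content p.2 + 1)) /
        (q ^ T p.1 * t ^ content p.1 - q ^ T p.2 * t ^ content p.2) =
    (∏ p ∈ invSet (hatCells μ (rkOmega μ T)) T (minTab (hatCells μ (rkOmega μ T)) T),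
      (1 - q ^ ((T p.2 : ℤ) - (T p.1 : ℤ)) * t ^ (content p.2 - content p.1 + 1)) /
        (1 - q ^ ((T p.2 : ℤ) - (T p.1 : ℤ)) * t ^ (content p.2 - content p.1))) *
      ∏ c ∈ activeCells μ T,
        (1 - q ^ (-(T c : ℤ)) * t ^ ((n : ℤ) - μ.card - content c)) /
          (1 - q ^ (-(T c : ℤ)) * t ^ ((rkOmega μ T : ℤ) - μ.card - content c)) := by
  have hr := (rkOmega_spec hT).1
  have hcard : μ.card ≤ rkOmega μ T := (Nat.le_add_right _ _).trans hr
  simp only [inversion_factor_eq hq ht, add_sub_right_comm]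
  rw [invSet_hatCells hT hn, Finset.prod_union (disjoint_invSet_product _ _ _),
    Finset.prod_product]
  congr 1
  refine Finset.prod_congr rfl fun c hc => ?_
  have hc2 := snd_lt_of_mem_hatCells hr (Finset.mem_filter.1 hc).1
  have htel := prod_Ico_div_of_ne_zero
    (f := fun j : ℕ => 1 - q ^ (-(T c : ℤ)) * t ^ ((j : ℤ) - content c))
    (a := rkOmega μ T - μ.card) (b := n - μ.card) (by omega)
    (fun j hj => hne _ _ (by simp only [content]; omega))
  rw [Nat.cast_sub hcard, Nat.cast_sub (hcard.trans hn)] at htel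
  rw [← htel, prod_firstRow]
  refine Finset.prod_congr rfl fun j hj => ?_
  have h0 : T (0, j) = 0 := firstRow_eq_zero hT
    (b := n - μ.card) (mem_firstRow.2 ⟨rfl, Finset.mem_Ico.1 hj⟩)
  have hcj : content (0, j) = j := by simp [content]
  simp only [h0, hcj, Nat.cast_zero, zero_sub, Nat.cast_add, Nat.cast_one, add_sub_right_comm]

theorem prod_hatCells_rkOmega (hT : IsOmega μ T) :
    ∏ c ∈ hatCells μ (rkOmega μ T),
        (1 - q ^ (-(T c : ℤ)) * t ^ ((rkOmega μ T : ℤ) - μ.card - content c)) =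
      (∏ c ∈ activeCells μ T,
        (1 - q ^ (-(T c : ℤ)) * t ^ ((rkOmega μ T : ℤ) - μ.card - content c))) *
        tPoch t (rkOmega μ T - μ.card - zeroCol T) := by
  have hcard : μ.card ≤ rkOmega μ T := (Nat.le_add_right _ _).trans (rkOmega_spec hT).1
  have hz := zeroCol_le hT
  have hcompl : ((hatCells μ (rkOmega μ T)).filter fun c => ¬ (0 < T c ∨ 0 < c.1)) =
      firstRow (zeroCol T) (rkOmega μ T - μ.card) := by
    ext ⟨i, j⟩
    rw [Finset.mem_filter, mem_hatCells, mem_firstRow]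
    cases i
    · have := apply_firstRow_eq_zero_iff hT (j := j)
      simp [cellN, this, and_comm]
    · simp
  rw [activeCells, ← Finset.prod_filter_mul_prod_filter_not _ (fun c => 0 < T c ∨ 0 < c.1), hcompl,
    prod_firstRow, Finset.prod_Ico_eq_prod_range, tPoch, ← Finset.prod_range_reflect]
  congr 1
  refine Finset.prod_congr rfl fun i hi => ?_
  rw [Finset.mem_range] at hi
  rw [(apply_firstRow_eq_zero_iff hT).2 (by omega), ← zpow_natCast t]
  simp only [Nat.cast_zero, neg_zero, zpow_zero, one_mul, content]
  congr 2
  omega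

/-- The factor by which `K_{T|_{λ^{(n)}}}` differs from its limit. -/
noncomputable def correction (q t : F) (μ : YoungDiagram) (T : ℕ × ℕ → ℕ) (n : ℕ) : F :=
  (∏ c ∈ activeCells μ T, (1 - q ^ (-(T c : ℤ)) * t ^ ((n : ℤ) - μ.card - content c))) /
    ∏ i ∈ Finset.range (μ.card + zeroCol T), (1 - t ^ (n - (μ.card + zeroCol T) + i + 1))

theorem Kcoef_hatCells (hT : IsOmega μ T) (hn : rkOmega μ T ≤ n) (hq : q ≠ 0) (ht : t ≠ 0)
    (hne : ∀ (m k : ℤ), 0 < k → 1 - q ^ m * t ^ k ≠ 0) :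
    Kcoef q t (hatCells μ n) T =
      (((1 - t) ^ rkOmega μ T * muFact t (hatCells μ (rkOmega μ T)) T /
          ∏ c ∈ hatCells μ (rkOmega μ T),
            (1 - q ^ (-(T c : ℤ)) * t ^ ((rkOmega μ T : ℤ) - (μ.card : ℤ) - content c))) *
        ∏ p ∈ invSet (hatCells μ (rkOmega μ T)) T (minTab (hatCells μ (rkOmega μ T)) T),
          (1 - q ^ ((T p.2 : ℤ) - (T p.1 : ℤ)) * t ^ (content p.2 - content p.1 + 1)) /
            (1 - q ^ ((T p.2 : ℤ) - (T p.1 : ℤ)) * t ^ (content p.2 - content p.1))) *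
      correction q t μ T n := by
  have hr := (rkOmega_spec hT).1
  have hcard : μ.card ≤ rkOmega μ T := (Nat.le_add_right _ _).trans hr
  have hz := zeroCol_le hT
  have h1t : (1 - t : F) ≠ 0 := by simpa using hne 0 1 one_pos
  have hpow : ∀ k : ℕ, (1 - t ^ (k + 1) : F) ≠ 0 := fun k => by
    simpa [← zpow_natCast] using hne 0 (k + 1 : ℕ) (by positivity)
  have hpoch : ∀ m, tPoch t m ≠ 0 := fun m => Finset.prod_ne_zero_iff.2 fun i _ => hpow i
  have hA : ∏ c ∈ activeCells μ T,
      (1 - q ^ (-(T c : ℤ)) * t ^ ((rkOmega μ T : ℤ) - μ.card - content c)) ≠ 0 := by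
    refine Finset.prod_ne_zero_iff.2 fun c hc => hne _ _ ?_
    have := snd_lt_of_mem_hatCells hr (Finset.mem_filter.1 hc).1
    simp only [content]
    omega
  have hR : ∏ i ∈ Finset.range (μ.card + zeroCol T),
      (1 - t ^ (n - (μ.card + zeroCol T) + i + 1)) ≠ 0 :=
    Finset.prod_ne_zero_iff.2 fun i _ => hpow _
  have hP := tPoch_add t (n - (μ.card + zeroCol T)) (μ.card + zeroCol T)
  rw [Nat.sub_add_cancel (by omega)] at hP
  have hmu := muFact_hatCells hT hn hne
  rw [Nat.sub_sub n] at hmu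
  have hexp : (1 - t) ^ n = (1 - t) ^ rkOmega μ T * (1 - t) ^ (n - rkOmega μ T) := by
    rw [← pow_add]
    congr 1
    omega
  have hlead : muFact t (hatCells μ n) T / tFact t n =
      (1 - t) ^ rkOmega μ T * muFact t (hatCells μ (rkOmega μ T)) T /
        (tPoch t (rkOmega μ T - μ.card - zeroCol T) *
          ∏ i ∈ Finset.range (μ.card + zeroCol T),
            (1 - t ^ (n - (μ.card + zeroCol T) + i + 1))) := by
    rw [tFact_eq, div_div_eq_mul_div, div_eq_div_iff (hpoch n) (mul_ne_zero (hpoch _) hR),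
      hexp, hP]
    linear_combination (1 - t) ^ rkOmega μ T * (∏ i ∈ Finset.range (μ.card + zeroCol T),
            (1 - t ^ (n - (μ.card + zeroCol T) + i + 1))) * hmu
  rw [Kcoef, card_hatCells (hcard.trans hn), prod_invSet_hatCells hT hn hq ht hne,
    prod_hatCells_rkOmega hT, hlead, correction]
  generalize (∏ p ∈ invSet (hatCells μ (rkOmega μ T)) T (minTab (hatCells μ (rkOmega μ T)) T),
    _ : F) = I
  rw [Finset.prod_div_distrib]
  have := hpoch (rkOmega μ T - μ.card - zeroCol T)
  field_simp

end Field

section Limit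

theorem qL_zpow_mul_tL_zpow (m k : ℤ) :
    qL ^ m * tL ^ k = HahnSeries.single k ((RatFunc.X : RatFunc ℚ) ^ m) := by
  have ht : tL ^ k = HahnSeries.single k (1 : RatFunc ℚ) := (RatFunc.single_zpow k).symm
  rw [qL, ← map_zpow₀, ht, HahnSeries.C_apply, HahnSeries.single_mul_single, zero_add, mul_one]

theorem qL_ne_zero : qL ≠ 0 := by
  simp [qL, RatFunc.X_ne_zero]

theorem tL_ne_zero : tL ≠ 0 := by
  simp [tL]

theorem one_sub_qL_zpow_mul_tL_zpow_ne_zero (m k : ℤ) (hk : 0 < k) :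
    1 - qL ^ m * tL ^ k ≠ 0 := by
  intro h
  rw [sub_eq_zero, qL_zpow_mul_tL_zpow] at h
  have := congrArg (fun f : LK => f.coeff 0) h
  simp [HahnSeries.coeff_single_of_ne hk.ne] at this

theorem tendsto_tL_pow : Filter.Tendsto (fun n : ℕ => tL ^ n) Filter.atTop (nhds 0) :=
  Valued.tendsto_zero_pow_of_le_exp_neg_one
    (LaurentSeries.valuation_single_zpow (RatFunc ℚ) 1).le

theorem tendsto_correction (μ : YoungDiagram) (T : ℕ × ℕ → ℕ) :
    Filter.Tendsto (correction qL tL μ T) Filter.atTop (nhds 1) := by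
  have hnum : Filter.Tendsto (fun n : ℕ => ∏ c ∈ activeCells μ T,
      (1 - qL ^ (-(T c : ℤ)) * tL ^ ((n : ℤ) - μ.card - content c))) Filter.atTop
      (nhds (∏ c ∈ activeCells μ T, (1 : LK))) := by
    refine tendsto_finsetProd _ fun c _ => ?_
    have h := (tendsto_tL_pow.const_mul
      (qL ^ (-(T c : ℤ)) * tL ^ (-(μ.card : ℤ) - content c))).const_sub 1
    rw [mul_zero, sub_zero] at h
    refine h.congr fun n => ?_
    rw [mul_assoc, ← zpow_natCast, ← zpow_add₀ tL_ne_zero]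
    congr 3
    ring
  have hden : Filter.Tendsto (fun n : ℕ => ∏ i ∈ Finset.range (μ.card + zeroCol T),
      (1 - tL ^ (n - (μ.card + zeroCol T) + i + 1))) Filter.atTop
      (nhds (∏ i ∈ Finset.range (μ.card + zeroCol T), (1 : LK))) := by
    refine tendsto_finsetProd _ fun i _ => ?_
    have hexp : Filter.Tendsto (fun n : ℕ => n - (μ.card + zeroCol T) + i + 1)
        Filter.atTop Filter.atTop :=
      Filter.tendsto_atTop_mono (fun n => by omega)
        (Filter.tendsto_sub_atTop_nat (μ.card + zeroCol T))
    have h := (tendsto_tL_pow.comp hexp).const_sub 1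
    rwa [sub_zero] at h
  rw [Finset.prod_const_one] at hnum hden
  rw [← div_one (1 : LK)]
  exact hnum.div hden one_ne_zero

end Limit

/-- Let `λ` be a partition and `T ∈ Ω(λ)`. Each restriction
`T|_{λ^{(n)}}` (for `n ≥ n_λ`) lies in `RSSYT(λ^{(n)})`, and the sequence
`(K_{T|_{λ^{(n)}}}(q,t))_{n ≥ n_λ}`, regarded in `K = ℚ(q)((t))`, converges in the
`t`-adic topology to the stated limit. -/
theorem statement18 (μ : YoungDiagram) (T : ℕ × ℕ → ℕ) (hT : IsOmega μ T) :
    (∀ n, nLam μ ≤ n → IsRSSYT (hatCells μ n) (restLam μ n T)) ∧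
    Filter.Tendsto (fun n => Kcoef qL tL (hatCells μ n) (restLam μ n T)) Filter.atTop
      (nhds
        (((1 - tL) ^ rkOmega μ T *
            muFact tL (hatCells μ (rkOmega μ T)) (restLam μ (rkOmega μ T) T) /
              ∏ c ∈ hatCells μ (rkOmega μ T),
                (1 - qL ^ (-(restLam μ (rkOmega μ T) T c : ℤ)) *
                  tL ^ ((rkOmega μ T : ℤ) - (μ.card : ℤ) - content c))) *
          ∏ p ∈ invSet (hatCells μ (rkOmega μ T)) (restLam μ (rkOmega μ T) T)
              (minTab (hatCells μ (rkOmega μ T)) (restLam μ (rkOmega μ T) T)),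
            (1 - qL ^ ((restLam μ (rkOmega μ T) T p.2 : ℤ) -
                  (restLam μ (rkOmega μ T) T p.1 : ℤ)) *
                tL ^ (content p.2 - content p.1 + 1)) /
              (1 - qL ^ ((restLam μ (rkOmega μ T) T p.2 : ℤ) -
                  (restLam μ (rkOmega μ T) T p.1 : ℤ)) *
                tL ^ (content p.2 - content p.1)))) := by
  have hrest := restLam_eq_self hT le_rfl
  refine ⟨fun n _ => isRSSYT_restLam hT, ?_⟩
  rw [hrest]
  have h := (tendsto_correction μ T).const_mul
    (((1 - tL) ^ rkOmega μ T * muFact tL (hatCells μ (rkOmega μ T)) T /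
        ∏ c ∈ hatCells μ (rkOmega μ T),
          (1 - qL ^ (-(T c : ℤ)) * tL ^ ((rkOmega μ T : ℤ) - (μ.card : ℤ) - content c))) *
      ∏ p ∈ invSet (hatCells μ (rkOmega μ T)) T (minTab (hatCells μ (rkOmega μ T)) T),
        (1 - qL ^ ((T p.2 : ℤ) - (T p.1 : ℤ)) * tL ^ (content p.2 - content p.1 + 1)) /
          (1 - qL ^ ((T p.2 : ℤ) - (T p.1 : ℤ)) * tL ^ (content p.2 - content p.1)))
  rw [mul_one] at h
  refine h.congr' ?_
  filter_upwards [Filter.eventually_ge_atTop (rkOmega μ T)] with n hn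
  rw [restLam_eq_self hT hn]
  exact (Kcoef_hatCells hT hn qL_ne_zero tL_ne_zero one_sub_qL_zpow_mul_tL_zpow_ne_zero).symm
end
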